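/- arXiv:2102.03909 — 2 statements merged into one kernel-verified Lean document; each statement's English description precedes it below -/
import Mathlib

section
/- Let φ_1, …, φ_n ∈ ℝ^P be feature vectors whose Gram matrix H ∈ ℝ^{n×n}, H_{ij} = ⟨φ_i, φ_j⟩, is invertible, let θ_0 ∈ ℝ^P, let u_0, Y ∈ ℝ^n, and define the squared loss of the linearized model L(θ) = (1/2) ∑_{i=1}^n ((u_0)_i + ⟨φ_i, θ − θ_0⟩ − Y_i)². If θ : ℝ → ℝ^P is a differentiable curve with θ(0) = θ_0 and θ'(t) = −∇L(θ(t)) for all t ≥ 0, then for every t ≥ 0 and every test feature vector ψ ∈ ℝ^P, ⟨ψ, θ(t) − θ_0⟩ = h(ψ)ᵀ H^{−1} (exp(−tH) − I)(u_0 − Y), where h(ψ) ∈ ℝ^n has entries h(ψ)_i = ⟨ψ, φ_i⟩ and exp denotes the matrix exponential. In particular, the vector u(t) ∈ ℝ^n of training predictions, u(t)_i = (u_0)_i + ⟨φ_i, θ(t) − θ_0⟩, equals u(t) = Y + exp(−tH)(u_0 − Y). (This is the closed-form adaptation formula, equation (5), for gradient-flow training of a model that is linear in its parameters, as in the NTK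 regime.) -/
open scoped RealInnerProductSpace

section MatrixODE

open Matrix

open scoped Matrix.Norms.Operator in
/-- The entries of `s ↦ exp (sA)` have the entries of `exp (sA) A` as derivatives. -/
theorem hasDerivAt_exp_smul_matrix_apply {ι : Type*} [Fintype ι] [DecidableEq ι]
    (A : Matrix ι ι ℝ) (s : ℝ) (i j : ι) :
    HasDerivAt (fun s : ℝ => NormedSpace.exp (s • A) i j) ((NormedSpace.exp (s • A) * A) i j) s :=
  (Matrix.entryLinearMap ℝ ℝ i j).toContinuousLinearMap.hasFDerivAt.comp_hasDerivAt s
    (hasDerivAt_exp_smul_const A s)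

/-- A solution on `[0, ∞)` of the linear system `dr/dt = -A r` is `exp (-tA) r(0)`. -/
theorem eq_exp_neg_smul_mulVec_of_hasDerivAt {ι : Type*} [Fintype ι] [DecidableEq ι]
    (A : Matrix ι ι ℝ) (r : ℝ → ι → ℝ)
    (hr : ∀ t, 0 ≤ t → HasDerivAt r (-(A *ᵥ r t)) t) {t : ℝ} (ht : 0 ≤ t) :
    r t = NormedSpace.exp (-(t • A)) *ᵥ r 0 := by
  have hderiv : ∀ s, 0 ≤ s →
      HasDerivAt (fun s : ℝ => NormedSpace.exp (s • A) *ᵥ r s) 0 s := by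
    intro s hs
    have hsum : HasDerivAt (fun s : ℝ => NormedSpace.exp (s • A) *ᵥ r s)
        ((NormedSpace.exp (s • A) * A) *ᵥ r s + NormedSpace.exp (s • A) *ᵥ (-(A *ᵥ r s))) s := by
      refine hasDerivAt_pi.2 fun i => ?_
      refine (HasDerivAt.fun_sum fun j _ => (hasDerivAt_exp_smul_matrix_apply A s i j).mul
        (hasDerivAt_pi.1 (hr s hs) j)).congr_deriv ?_
      exact Finset.sum_add_distrib
    rwa [Matrix.mulVec_neg, Matrix.mulVec_mulVec, add_neg_cancel] at hsum
  have hconst : NormedSpace.exp (t • A) *ᵥ r t = NormedSpace.exp ((0 : ℝ) • A) *ᵥ r 0 :=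
    constant_of_has_deriv_right_zero (f := fun s : ℝ => NormedSpace.exp (s • A) *ᵥ r s)
      (fun s hs => (hderiv s hs.1).continuousAt.continuousWithinAt)
      (fun s hs => (hderiv s hs.1).hasDerivWithinAt) t ⟨ht, le_rfl⟩
  have hdet : IsUnit (NormedSpace.exp (t • A)).det :=
    (Matrix.isUnit_iff_isUnit_det _).1 (Matrix.isUnit_exp _)
  rw [zero_smul, NormedSpace.exp_zero, Matrix.one_mulVec] at hconst
  rw [← hconst, Matrix.mulVec_mulVec, Matrix.exp_neg, Matrix.nonsing_inv_mul _ hdet,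
    Matrix.one_mulVec]

end MatrixODE

/-- The gradient of the squared loss of an affine model is the residual-weighted sum of features. -/
theorem hasGradientAt_half_sum_sq_inner_sub {E ι : Type*} [NormedAddCommGroup E]
    [InnerProductSpace ℝ E] [CompleteSpace E] [Fintype ι] (φ : ι → E) (x₀ : E) (u Y : ι → ℝ)
    (x : E) :
    HasGradientAt (fun x => (1 / 2 : ℝ) * ∑ i, (u i + ⟪φ i, x - x₀⟫ - Y i) ^ 2)
      (∑ i, (u i + ⟪φ i, x - x₀⟫ - Y i) • φ i) x := by
  rw [hasGradientAt_iff_hasFDerivAt]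
  have h : ∀ i, HasFDerivAt (fun x => u i + ⟪φ i, x - x₀⟫ - Y i) (innerSL ℝ (φ i)) x := fun i =>
    (((innerSL ℝ (φ i)).hasFDerivAt.comp x ((hasFDerivAt_id x).sub_const x₀)).const_add
      (u i)).sub_const (Y i)
  refine ((HasFDerivAt.fun_sum fun i _ => (h i).pow 2).const_mul (1 / 2 : ℝ)).congr_fderiv ?_
  ext v
  simp only [map_sum, map_smul, smul_apply,
    sum_apply, innerSL_apply_apply, InnerProductSpace.toDual_apply_apply,
    Finset.smul_sum, smul_eq_mul]
  exact Finset.sum_congr rfl fun i _ => by ring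

/-- **Closed-form adaptation (equation (5)).** For a model linear in its parameters
(the NTK regime) with features `φᵢ`, invertible Gram matrix `H`, initial predictions
`u₀` and targets `Y`, the gradient flow of the squared loss admits a closed form: for
every test feature `ψ`, `⟪ψ, θ(t) − θ₀⟫ = h(ψ)ᵀ H⁻¹ (exp(−tH) − I)(u₀ − Y)`, and the
training predictions satisfy `u(t) = Y + exp(−tH)(u₀ − Y)`. -/
theorem closed_form_linear_model_gradient_flow
    {P n : ℕ} (φ : Fin n → EuclideanSpace ℝ (Fin P))
    (H : Matrix (Fin n) (Fin n) ℝ)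
    (hH : H = Matrix.of fun i j => ⟪φ i, φ j⟫)
    (hHinv : IsUnit H)
    (θ₀ : EuclideanSpace ℝ (Fin P)) (u₀ Y : Fin n → ℝ)
    (L : EuclideanSpace ℝ (Fin P) → ℝ)
    (hLdef : L = fun θ => (1 / 2 : ℝ) * ∑ i, (u₀ i + ⟪φ i, θ - θ₀⟫ - Y i) ^ 2)
    (θ : ℝ → EuclideanSpace ℝ (Fin P)) (hθ₀ : θ 0 = θ₀)
    (hθ : ∀ t : ℝ, 0 ≤ t → HasDerivAt θ (-(gradient L (θ t))) t) :
    ∀ t : ℝ, 0 ≤ t →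
      (∀ ψ : EuclideanSpace ℝ (Fin P),
        ⟪ψ, θ t - θ₀⟫ =
          dotProduct (fun i => ⟪ψ, φ i⟫)
            (Matrix.mulVec (H⁻¹ * (NormedSpace.exp (-(t • H)) - 1)) (u₀ - Y))) ∧
      (fun i => u₀ i + ⟪φ i, θ t - θ₀⟫) =
        (fun i => Y i + Matrix.mulVec (NormedSpace.exp (-(t • H))) (u₀ - Y) i) := by
  subst hLdef
  let r : ℝ → Fin n → ℝ := fun s i => u₀ i + ⟪φ i, θ s - θ₀⟫ - Y i
  have hr₀ : r 0 = u₀ - Y := by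
    ext i
    simp [r, hθ₀]
  have hinner : ∀ s, 0 ≤ s → ∀ ψ : EuclideanSpace ℝ (Fin P),
      HasDerivAt (fun s => ⟪ψ, θ s - θ₀⟫) (-(dotProduct (fun i => ⟪ψ, φ i⟫) (r s))) s := by
    intro s hs ψ
    have hd := hθ s hs
    rw [(hasGradientAt_half_sum_sq_inner_sub φ θ₀ u₀ Y (θ s)).gradient] at hd
    have := (innerSL ℝ ψ).hasFDerivAt.comp_hasDerivAt s (hd.sub_const θ₀)
    refine this.congr_deriv ?_
    simp only [map_neg, map_sum, map_smul, innerSL_apply_apply, smul_eq_mul, dotProduct, r]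
    exact congrArg _ (Finset.sum_congr rfl fun i _ => mul_comm _ _)
  have hr : ∀ s, 0 ≤ s → HasDerivAt r (-(H.mulVec (r s))) s := by
    intro s hs
    refine hasDerivAt_pi.2 fun i => ?_
    subst hH
    exact ((hinner s hs (φ i)).const_add (u₀ i)).sub_const (Y i)
  intro t ht
  have hrt : r t = Matrix.mulVec (NormedSpace.exp (-(t • H))) (u₀ - Y) := by
    rw [← hr₀]
    exact eq_exp_neg_smul_mulVec_of_hasDerivAt H r hr ht
  refine ⟨fun ψ => ?_, ?_⟩
  · let h : Fin n → ℝ := fun i => ⟪ψ, φ i⟫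
    let ℓ : (Fin n → ℝ) →L[ℝ] ℝ :=
      (dotProductBilin ℝ ℝ h ∘ₗ Matrix.mulVecLin H⁻¹).toContinuousLinearMap
    have hℓ : ∀ v, ℓ v = dotProduct h (H⁻¹.mulVec v) := fun _ => rfl
    have hdet : IsUnit H.det := (Matrix.isUnit_iff_isUnit_det _).1 hHinv
    -- `⟪ψ, θ - θ₀⟫ - hᵀ H⁻¹ r` is conserved, since `H⁻¹ (dr/ds) = -r`.
    have hderiv : ∀ s, 0 ≤ s → HasDerivAt (fun s => ⟪ψ, θ s - θ₀⟫ - ℓ (r s)) 0 s := by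
      intro s hs
      refine ((hinner s hs ψ).sub (ℓ.hasFDerivAt.comp_hasDerivAt s (hr s hs))).congr_deriv ?_
      rw [map_neg, hℓ, Matrix.mulVec_mulVec, Matrix.nonsing_inv_mul _ hdet, Matrix.one_mulVec,
        sub_self]
    have hconst := constant_of_has_deriv_right_zero
      (fun s hs => (hderiv s hs.1).continuousAt.continuousWithinAt)
      (fun s hs => (hderiv s hs.1).hasDerivWithinAt) t ⟨ht, le_rfl⟩
    rw [hθ₀, sub_self, inner_zero_right, hr₀, hrt, hℓ, hℓ] at hconst
    rw [← Matrix.mulVec_mulVec, Matrix.sub_mulVec, Matrix.one_mulVec, Matrix.mulVec_sub,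
      dotProduct_sub]
    linarith
  · ext i
    rw [← hrt]
    simp only [r]
    ring
end

section
/- Let φ_1, …, φ_n ∈ ℝ^P be feature vectors whose Gram matrix H ∈ ℝ^{n×n}, H_{ij} = ⟨φ_i, φ_j⟩, is invertible, let θ_0 ∈ ℝ^P, u_0, Y ∈ ℝ^n, and L(θ) = (1/2) ∑_{i=1}^n ((u_0)_i + ⟨φ_i, θ − θ_0⟩ − Y_i)². Let θ : ℝ → ℝ^P be a differentiable curve with θ(0) = θ_0 and θ'(t) = −∇L(θ(t)) for all t ≥ 0. Then as t → ∞: (i) for every ψ ∈ ℝ^P, ⟨ψ, θ(t) − θ_0⟩ converges to h(ψ)ᵀ H^{−1}(Y − u_0), where h(ψ)_i = ⟨ψ, φ_i⟩; and (ii) the training predictions interpolate the targets in the limit: for every i, (u_0)_i + ⟨φ_i, θ(t) − θ_0⟩ → Y_i. (This is the infinite-time limit, equation (6), of the closed-form NTK adaptation, together with the fact that it exactly fits the training data.) -/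
open scoped RealInnerProductSpace

section GradientFlow

open Filter Set

variable {E : Type*} [NormedAddCommGroup E] [InnerProductSpace ℝ E]

/-- A nonnegative function with `f' ≤ -c f` on `[0, ∞)`, `c > 0`, tends to zero. -/
theorem tendsto_zero_of_hasDerivAt_le_neg_mul {f f' : ℝ → ℝ} {c : ℝ} (hc : 0 < c)
    (hf : ∀ t, 0 ≤ f t) (hderiv : ∀ t, 0 ≤ t → HasDerivAt f (f' t) t)
    (hle : ∀ t, 0 ≤ t → f' t ≤ -c * f t) : Tendsto f atTop (nhds 0) := by
  have hg : ∀ t, 0 ≤ t → HasDerivAt (fun s => f s * Real.exp (c * s))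
      (f' t * Real.exp (c * t) + f t * (Real.exp (c * t) * (c * 1))) t := fun t ht =>
    (hderiv t ht).mul (((hasDerivAt_id t).const_mul c).exp)
  have hanti : AntitoneOn (fun s => f s * Real.exp (c * s)) (Ici 0) := by
    refine antitoneOn_of_hasDerivWithinAt_nonpos (convex_Ici 0)
      (fun t ht => (hg t ht).continuousAt.continuousWithinAt)
      (fun t ht => (hg t (interior_subset ht)).hasDerivWithinAt) fun t ht => ?_
    nlinarith [hle t (interior_subset ht), Real.exp_pos (c * t)]
  have hbound : ∀ t, 0 ≤ t → f t ≤ f 0 * Real.exp (-(c * t)) := by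
    intro t ht
    have h : f t * Real.exp (c * t) ≤ f 0 := by simpa using hanti self_mem_Ici ht ht
    rw [Real.exp_neg, ← div_eq_mul_inv]
    exact (le_div_iff₀ (Real.exp_pos _)).2 h
  have hlim : Tendsto (fun t => f 0 * Real.exp (-(c * t))) atTop (nhds 0) := by
    simpa using (Real.tendsto_exp_neg_atTop_nhds_zero.comp
      (tendsto_id.const_mul_atTop hc)).const_mul (f 0)
  exact squeeze_zero' (Eventually.of_forall hf)
    ((eventually_ge_atTop 0).mono hbound) hlim

/-- The Gram matrix applied to a coefficient vector pairs the features with their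
linear combination. -/
theorem gram_mulVec_eq_inner_sum {ι : Type*} [Fintype ι] (φ : ι → E) (r : ι → ℝ) (i : ι) :
    (Matrix.of fun i j => ⟪φ i, φ j⟫).mulVec r i = ⟪φ i, ∑ j, r j • φ j⟫ := by
  simp [Matrix.mulVec, dotProduct, inner_sum, real_inner_smul_right, mul_comm]

/-- If the Gram matrix is invertible, the squared norm of a linear combination of the
features dominates the sum of squares of its coefficients. -/
theorem exists_pos_mul_sum_sq_le_norm_sq {ι : Type*} [Fintype ι] [DecidableEq ι] (φ : ι → E)
    (h : IsUnit (Matrix.of fun i j => ⟪φ i, φ j⟫)) :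
    ∃ c > 0, ∀ r : ι → ℝ, c * ∑ i, r i ^ 2 ≤ ‖∑ i, r i • φ i‖ ^ 2 := by
  let A : EuclideanSpace ℝ ι →ₗ[ℝ] E :=
    Fintype.linearCombination ℝ φ ∘ₗ (WithLp.linearEquiv 2 ℝ (ι → ℝ)).toLinearMap
  have hA : ∀ r, A r = ∑ i, r i • φ i := fun r => by
    simp [A, Fintype.linearCombination_apply]
  have hker : LinearMap.ker A = ⊥ := by
    refine LinearMap.ker_eq_bot'.2 fun r hr => ?_
    have h0 : (Matrix.of fun i j => ⟪φ i, φ j⟫).mulVec r.ofLp = 0 := by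
      ext i
      rw [gram_mulVec_eq_inner_sum, ← hA, hr, inner_zero_right, Pi.zero_apply]
    have : r.ofLp = 0 := Matrix.mulVec_injective_of_isUnit h (by simpa using h0)
    ext i
    simp [this]
  obtain ⟨K, hK, hlip⟩ := A.exists_antilipschitzWith hker
  have hK' : (0 : ℝ) < K := hK
  refine ⟨((K : ℝ) ^ 2)⁻¹, by positivity, fun r => ?_⟩
  have hr := hlip.le_mul_dist (WithLp.toLp 2 r) 0
  rw [map_zero, dist_zero_right, dist_zero_right, hA] at hr
  have hsq := pow_le_pow_left₀ (norm_nonneg _) hr 2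
  rw [EuclideanSpace.real_norm_sq_eq, mul_pow] at hsq
  exact (inv_mul_le_iff₀ (by positivity)).2 hsq

/-- The gradient of the squared loss of a model that is linear in its parameters. -/
theorem gradient_half_sum_sq [CompleteSpace E] {ι : Type*} [Fintype ι] (φ : ι → E) (θ₀ : E)
    (u₀ Y : ι → ℝ) (x : E) :
    gradient (fun θ => (1 / 2 : ℝ) * ∑ i, (u₀ i + ⟪φ i, θ - θ₀⟫ - Y i) ^ 2) x =
      ∑ i, (u₀ i + ⟪φ i, x - θ₀⟫ - Y i) • φ i := by
  refine HasGradientAt.gradient ?_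
  rw [hasGradientAt_iff_hasFDerivAt]
  have hr : ∀ i, HasFDerivAt (fun θ => u₀ i + ⟪φ i, θ - θ₀⟫ - Y i) (innerSL ℝ (φ i)) x :=
    fun i => (((innerSL ℝ (φ i)).hasFDerivAt.comp x
      ((hasFDerivAt_id x).sub_const θ₀)).const_add (u₀ i)).sub_const (Y i)
  have hL := (HasFDerivAt.fun_sum (u := Finset.univ)
    fun i _ => (hr i).pow 2).const_mul (1 / 2 : ℝ)
  refine hL.congr_fderiv ?_
  ext v
  simp [Finset.mul_sum]
  ring_nf

/-- Along a curve whose velocity is orthogonal to `w`, the pairing with `w` is conserved. -/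
theorem inner_sub_eq_zero_of_hasDerivAt {θ θ' : ℝ → E} {w : E}
    (hθ : ∀ t, 0 ≤ t → HasDerivAt θ (θ' t) t) (hw : ∀ t, 0 ≤ t → ⟪w, θ' t⟫ = 0)
    {t : ℝ} (ht : 0 ≤ t) : ⟪w, θ t - θ 0⟫ = 0 := by
  have hd : ∀ s, 0 ≤ s → HasDerivAt (fun s => ⟪w, θ s⟫) 0 s := fun s hs => by
    refine ((innerSL ℝ w).hasFDerivAt.comp_hasDerivAt s (hθ s hs)).congr_deriv ?_
    simpa using hw s hs
  have := constant_of_has_deriv_right_zero (a := 0) (b := t)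
    (fun s hs => (hd s hs.1).continuousAt.continuousWithinAt)
    (fun s hs => (hd s hs.1).hasDerivWithinAt) t ⟨ht, le_rfl⟩
  rw [inner_sub_right, this, sub_self]

end GradientFlow

open Filter in
/-- **Infinite-time limit of the closed-form NTK adaptation (equation (6)).** For a model
linear in its parameters with features `φᵢ`, invertible Gram matrix `H`, initial
predictions `u₀` and targets `Y`, along the gradient flow of the squared loss:
(i) `⟪ψ, θ(t) − θ₀⟫ → h(ψ)ᵀ H⁻¹ (Y − u₀)` as `t → ∞`, for every test feature `ψ`; and
(ii) the training predictions interpolate the targets in the limit. -/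
theorem closed_form_linear_model_infinite_time_limit
    {P n : ℕ} (φ : Fin n → EuclideanSpace ℝ (Fin P))
    (H : Matrix (Fin n) (Fin n) ℝ)
    (hH : H = Matrix.of fun i j => ⟪φ i, φ j⟫)
    (hHinv : IsUnit H)
    (θ₀ : EuclideanSpace ℝ (Fin P)) (u₀ Y : Fin n → ℝ)
    (L : EuclideanSpace ℝ (Fin P) → ℝ)
    (hLdef : L = fun θ => (1 / 2 : ℝ) * ∑ i, (u₀ i + ⟪φ i, θ - θ₀⟫ - Y i) ^ 2)
    (θ : ℝ → EuclideanSpace ℝ (Fin P)) (hθ₀ : θ 0 = θ₀)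
    (hθ : ∀ t : ℝ, 0 ≤ t → HasDerivAt θ (-(gradient L (θ t))) t) :
    (∀ ψ : EuclideanSpace ℝ (Fin P),
      Tendsto (fun t : ℝ => ⟪ψ, θ t - θ₀⟫) atTop
        (nhds (dotProduct (fun i => ⟪ψ, φ i⟫)
          (Matrix.mulVec H⁻¹ (Y - u₀))))) ∧
    ∀ i : Fin n,
      Tendsto (fun t : ℝ => u₀ i + ⟪φ i, θ t - θ₀⟫) atTop (nhds (Y i)) := by
  subst hH hLdef
  simp only [gradient_half_sum_sq] at hθ
  set H : Matrix (Fin n) (Fin n) ℝ := Matrix.of fun i j => ⟪φ i, φ j⟫ with hH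
  let r : ℝ → Fin n → ℝ := fun t i => u₀ i + ⟪φ i, θ t - θ₀⟫ - Y i
  let v : ℝ → EuclideanSpace ℝ (Fin P) := fun t => ∑ i, r t i • φ i
  have hθ' : ∀ t, 0 ≤ t → HasDerivAt θ (-v t) t := hθ
  obtain ⟨c, hc, hbound⟩ := exists_pos_mul_sum_sq_le_norm_sq φ hHinv
  have hrderiv : ∀ t, 0 ≤ t → ∀ i, HasDerivAt (fun s => r s i) (-⟪φ i, v t⟫) t := by
    intro t ht i
    refine ((((innerSL ℝ (φ i)).hasFDerivAt.comp_hasDerivAt t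
      ((hθ' t ht).sub_const θ₀)).const_add (u₀ i)).sub_const (Y i)).congr_deriv ?_
    simp
  have hsq : Tendsto (fun t => ∑ i, r t i ^ 2) atTop (nhds 0) := by
    refine tendsto_zero_of_hasDerivAt_le_neg_mul (f' := fun t => -2 * ‖v t‖ ^ 2)
      (c := 2 * c) (by positivity) (fun t => by positivity) (fun t ht => ?_) fun t _ => ?_
    · refine (HasDerivAt.fun_sum (u := Finset.univ)
        fun i _ => (hrderiv t ht i).pow 2).congr_deriv ?_
      have hv : ‖v t‖ ^ 2 = ∑ i, r t i * ⟪φ i, v t⟫ := by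
        rw [← real_inner_self_eq_norm_sq]
        conv_lhs => rw [show v t = ∑ i, r t i • φ i from rfl, sum_inner]
        simp only [real_inner_smul_left]
        rfl
      rw [hv, Finset.mul_sum]
      refine Finset.sum_congr rfl fun i _ => ?_
      push_cast
      ring
    · linarith [hbound (r t)]
  have hr : ∀ i, Tendsto (fun t => r t i) atTop (nhds 0) := by
    intro i
    have hi : Tendsto (fun t => r t i ^ 2) atTop (nhds 0) :=
      squeeze_zero (fun t => sq_nonneg _)
        (fun t => Finset.single_le_sum (f := fun j => r t j ^ 2)
          (fun j _ => sq_nonneg _) (Finset.mem_univ i)) hsq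
    refine (tendsto_zero_iff_abs_tendsto_zero _).2 ?_
    simpa [Function.comp_def, Real.sqrt_sq_eq_abs] using hi.sqrt
  have hfit : ∀ i, Tendsto (fun t => u₀ i + ⟪φ i, θ t - θ₀⟫) atTop (nhds (Y i)) := by
    intro i
    simpa [r] using (hr i).add_const (Y i)
  refine ⟨fun ψ => ?_, hfit⟩
  let a : Fin n → ℝ := Matrix.vecMul (fun i => ⟪ψ, φ i⟫) H⁻¹
  have hdet : IsUnit H.det := (Matrix.isUnit_iff_isUnit_det H).1 hHinv
  have horth : ∀ j, ⟪ψ - ∑ i, a i • φ i, φ j⟫ = 0 := by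
    intro j
    have ha : Matrix.vecMul a H j = ⟪ψ, φ j⟫ := by
      simp [a, Matrix.vecMul_vecMul, Matrix.nonsing_inv_mul H hdet]
    rw [inner_sub_left, ← ha, sum_inner]
    simp [Matrix.vecMul, dotProduct, hH, real_inner_smul_left]
  have hψ : ∀ t, 0 ≤ t → ∑ i, a i * ⟪φ i, θ t - θ₀⟫ = ⟪ψ, θ t - θ₀⟫ := by
    intro t ht
    have h := inner_sub_eq_zero_of_hasDerivAt (w := ψ - ∑ i, a i • φ i) hθ'
      (fun s _ => by simp only [v, inner_neg_right, inner_sum, real_inner_smul_right, horth,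
        mul_zero, Finset.sum_const_zero, neg_zero]) ht
    rw [hθ₀, inner_sub_left, sum_inner] at h
    simp only [real_inner_smul_left] at h
    linarith
  rw [Matrix.dotProduct_mulVec]
  refine Tendsto.congr' ((eventually_ge_atTop 0).mono hψ)
    (tendsto_finsetSum _ fun i _ => Tendsto.const_mul (a i) ?_)
  simpa using (hfit i).sub_const (u₀ i)
end
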